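/- Let α, β, γ, δ ∈ F₃, let G = F₃/N be the group presented by generators g₁, g₂, g₃ and relations α = β and γ = δ (N the normal closure of {αβ⁻¹, γδ⁻¹}), and let ι : F₃ → G be the quotient map. Let Ī be the ideal of ℂ[x₁, x₂, x₃, x₁₂, x₁₃, x₂₃, x₁₂₃] generated by K together with fixed polynomials P_{αg} − P_{βg} and P_{γg} − P_{δg} for g = g₁^{i₁}g₂^{i₂}g₃^{i₃}, 0 ≤ i₁, i₂, i₃ ≤ 1, where Φ(P_w) = [w] for each such word w. Then for all u, v ∈ F₃ with ι(u) = ι(v) and all polynomials P_u, P_v with Φ(P_u) = [u] and Φ(P_v) = [v], one has P_u − P_v ∈ Ī. -/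

import Mathlib

open MvPolynomial

noncomputable section

def skeinIdeal (R G : Type*) [CommRing R] [Group G] : Ideal (MvPolynomial G R) :=
  Ideal.span ({X (1 : G) - 2} ∪
    {p | ∃ g h : G, p = X g * X h - X (g * h) - X (g * h⁻¹)})

abbrev SkeinAlgebra (R G : Type*) [CommRing R] [Group G] :=
  MvPolynomial G R ⧸ skeinIdeal R G

def cl (R : Type*) {G : Type*} [CommRing R] [Group G] (g : G) : SkeinAlgebra R G :=
  Ideal.Quotient.mk (skeinIdeal R G) (X g)

/-- The free group on three generators. -/
abbrev F3 := FreeGroup (Fin 3)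

def g1 : F3 := FreeGroup.of 0
def g2 : F3 := FreeGroup.of 1
def g3 : F3 := FreeGroup.of 2

/-- The words `g₁, g₂, g₃, g₁g₂, g₁g₃, g₂g₃, g₁g₂g₃` indexed by the seven variables
`x₁, x₂, x₃, x₁₂, x₁₃, x₂₃, x₁₂₃`. -/
def word : Fin 7 → F3 := ![g1, g2, g3, g1 * g2, g1 * g3, g2 * g3, g1 * g2 * g3]

/-- `Φ : ℂ[x₁,…,x₁₂₃] → S(F₃;ℂ)`, `x_{i₁⋯i_k} ↦ [g_{i₁}⋯g_{i_k}]`. -/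
def Phi : MvPolynomial (Fin 7) ℂ →ₐ[ℂ] SkeinAlgebra ℂ F3 :=
  aeval fun i => cl ℂ (word i)

-- the seven variables
def x1 : MvPolynomial (Fin 7) ℂ := X 0
def x2 : MvPolynomial (Fin 7) ℂ := X 1
def x3 : MvPolynomial (Fin 7) ℂ := X 2
def x12 : MvPolynomial (Fin 7) ℂ := X 3
def x13 : MvPolynomial (Fin 7) ℂ := X 4
def x23 : MvPolynomial (Fin 7) ℂ := X 5
def x123 : MvPolynomial (Fin 7) ℂ := X 6

/-- The polynomial `K`. -/
def K : MvPolynomial (Fin 7) ℂ :=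
  x123 ^ 2 - (x12 * x3 + x13 * x2 + x23 * x1 - x1 * x2 * x3) * x123
    + x1 ^ 2 + x2 ^ 2 + x3 ^ 2 + x12 ^ 2 + x23 ^ 2 + x13 ^ 2
    - x1 * x2 * x12 - x1 * x3 * x13 - x2 * x3 * x23 + x12 * x13 * x23 - 4

/-- `g = g₁^{i₁} g₂^{i₂} g₃^{i₃}` with `0 ≤ i₁, i₂, i₃ ≤ 1`. -/
def gpow (i : Fin 2 × Fin 2 × Fin 2) : F3 :=
  g1 ^ (i.1 : ℕ) * g2 ^ (i.2.1 : ℕ) * g3 ^ (i.2.2 : ℕ)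

section SkeinIdentities

variable {R G : Type*} [CommRing R] [Group G]

theorem cl_one : cl R (1 : G) = 2 := by
  have h : (X (1 : G) - 2 : MvPolynomial G R) ∈ skeinIdeal R G :=
    Ideal.subset_span (Or.inl rfl)
  rw [← Ideal.Quotient.eq_zero_iff_mem, map_sub, sub_eq_zero] at h
  rw [cl, h, map_ofNat]

theorem cl_mul_cl (g h : G) : cl R g * cl R h = cl R (g * h) + cl R (g * h⁻¹) := by
  have hm : (X g * X h - X (g * h) - X (g * h⁻¹) : MvPolynomial G R) ∈ skeinIdeal R G :=
    Ideal.subset_span (Or.inr ⟨g, h, rfl⟩)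
  rw [← Ideal.Quotient.eq_zero_iff_mem, map_sub, map_sub, map_mul, sub_sub, sub_eq_zero] at hm
  exact hm

theorem cl_inv (g : G) : cl R g⁻¹ = cl R g := by
  have h := cl_mul_cl (R := R) 1 g
  rw [cl_one, one_mul, one_mul] at h
  linear_combination -h

theorem cl_mul_comm (g h : G) : cl R (g * h) = cl R (h * g) := by
  have h₁ := cl_mul_cl (R := R) g h
  have h₂ := cl_mul_cl (R := R) h g
  have h₃ := cl_inv (R := R) (g * h⁻¹)
  rw [mul_inv_rev, inv_inv] at h₃
  linear_combination h₂ - h₁ + h₃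

/-- The trace identity corresponding to the Cayley–Hamilton theorem. -/
theorem cl_mul_mul_self (h a : G) :
    cl R (h * (a * a)) = cl R a * cl R (h * a) - cl R h := by
  have h₁ := cl_mul_cl (R := R) (h * a) a
  rw [mul_inv_cancel_right, mul_assoc] at h₁
  linear_combination -h₁

/-- The polarized Cayley–Hamilton trace identity. -/
theorem cl_mul_swap (h a b : G) :
    cl R (h * (b * a)) = cl R b * cl R (h * a) + cl R a * cl R (h * b)
      + (cl R (a * b) - cl R a * cl R b) * cl R h - cl R (h * (a * b)) := by
  have h₁ := cl_mul_cl (R := R) (h * b) a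
  have h₂ := cl_mul_cl (R := R) (h * a) b
  have h₃ := cl_mul_cl (R := R) h (a * b⁻¹)
  have h₄ := cl_mul_cl (R := R) a b
  rw [mul_inv_rev, inv_inv] at h₃
  simp only [mul_assoc] at h₁ h₂ h₃ h₄ ⊢
  linear_combination -h₁ - h₂ + h₃ + cl R h * h₄

end SkeinIdentities

section OrderedWords

theorem cl_word_mem (i : Fin 7) : cl ℂ (word i) ∈ Phi.range :=
  ⟨X i, by simp [Phi]⟩

/-- The trace functional `h ↦ [h w]` on `F₃`. -/
def traceFun (w : F3) : F3 → SkeinAlgebra ℂ F3 := fun h => cl ℂ (h * w)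

/-- The span of the trace functionals of the ordered words, over the range of `Φ`. -/
def orderedSpan : Submodule Phi.range (F3 → SkeinAlgebra ℂ F3) :=
  Submodule.span Phi.range (Set.range fun i => traceFun (gpow i))

theorem traceFun_gpow_mem (i : Fin 2 × Fin 2 × Fin 2) : traceFun (gpow i) ∈ orderedSpan :=
  Submodule.subset_span ⟨i, rfl⟩

theorem traceFun_mul_mem_of_gpow {k : F3}
    (hk : ∀ i, traceFun (gpow i * k) ∈ orderedSpan) {w : F3}
    (hw : traceFun w ∈ orderedSpan) : traceFun (w * k) ∈ orderedSpan := by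
  have key : ∀ f ∈ orderedSpan, (fun h => f (k * h)) ∈ orderedSpan := by
    intro f hf
    induction hf using Submodule.span_induction with
    | mem f hf =>
      obtain ⟨i, rfl⟩ := hf
      convert hk i using 1
      funext h
      simp only [traceFun]
      rw [mul_assoc, cl_mul_comm, mul_assoc]
    | zero => exact orderedSpan.zero_mem
    | add f g _ _ hf hg => exact orderedSpan.add_mem hf hg
    | smul a f _ hf => exact orderedSpan.smul_mem a hf
  convert key _ hw using 1
  funext h
  simp only [traceFun]
  rw [mul_assoc k, cl_mul_comm k, mul_assoc]

theorem traceFun_mul_inv_mem {k w : F3} (hc : cl ℂ k ∈ Phi.range)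
    (hw : traceFun w ∈ orderedSpan) (hwk : traceFun (w * k) ∈ orderedSpan) :
    traceFun (w * k⁻¹) ∈ orderedSpan := by
  convert orderedSpan.sub_mem (orderedSpan.smul_mem ⟨_, hc⟩ hw) hwk using 1
  funext h
  have := cl_mul_cl (R := ℂ) (h * w) k
  simp only [traceFun, Pi.sub_apply, Pi.smul_apply, Subalgebra.smul_def, smul_eq_mul,
    ← mul_assoc]
  linear_combination -this

theorem traceFun_mul_mul_self_mem {k w : F3} (hc : cl ℂ k ∈ Phi.range)
    (hw : traceFun w ∈ orderedSpan) (hwk : traceFun (w * k) ∈ orderedSpan) :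
    traceFun (w * k * k) ∈ orderedSpan := by
  convert orderedSpan.sub_mem (orderedSpan.smul_mem ⟨_, hc⟩ hwk) hw using 1
  funext h
  have := cl_mul_mul_self (R := ℂ) (h * w) k
  simp only [traceFun, Pi.sub_apply, Pi.smul_apply, Subalgebra.smul_def, smul_eq_mul,
    ← mul_assoc] at this ⊢
  linear_combination this

theorem traceFun_swap_mem {a b w : F3} (ha : cl ℂ a ∈ Phi.range) (hb : cl ℂ b ∈ Phi.range)
    (hab : cl ℂ (a * b) ∈ Phi.range)
    (hw : traceFun w ∈ orderedSpan) (hwa : traceFun (w * a) ∈ orderedSpan)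
    (hwb : traceFun (w * b) ∈ orderedSpan) (hwab : traceFun (w * a * b) ∈ orderedSpan) :
    traceFun (w * b * a) ∈ orderedSpan := by
  convert orderedSpan.sub_mem (orderedSpan.add_mem (orderedSpan.add_mem
    (orderedSpan.smul_mem ⟨_, hb⟩ hwa) (orderedSpan.smul_mem ⟨_, ha⟩ hwb))
    (orderedSpan.smul_mem ⟨_, Phi.range.sub_mem hab (Phi.range.mul_mem ha hb)⟩ hw)) hwab using 1
  funext h
  have := cl_mul_swap (R := ℂ) (h * w) a b
  simp only [traceFun, Pi.sub_apply, Pi.add_apply, Pi.smul_apply, Subalgebra.smul_def,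
    smul_eq_mul, ← mul_assoc] at this ⊢
  linear_combination this

theorem traceFun_mul_g3_mem {w : F3} (hw : traceFun w ∈ orderedSpan) :
    traceFun (w * g3) ∈ orderedSpan := by
  refine traceFun_mul_mem_of_gpow ?_ hw
  rintro ⟨a, b, c⟩
  have h₀ := traceFun_gpow_mem (a, b, 0)
  have h₁ := traceFun_gpow_mem (a, b, 1)
  fin_cases c
  · simpa [gpow] using h₁
  · simp only [gpow, Fin.val_zero, Fin.val_one, pow_zero, pow_one, mul_one] at h₀ h₁ ⊢
    exact traceFun_mul_mul_self_mem (cl_word_mem 2) h₀ h₁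

theorem traceFun_mul_g2_mem {w : F3} (hw : traceFun w ∈ orderedSpan) :
    traceFun (w * g2) ∈ orderedSpan := by
  refine traceFun_mul_mem_of_gpow ?_ hw
  have base : ∀ a b : Fin 2, traceFun (g1 ^ (a : ℕ) * g2 ^ (b : ℕ) * g2) ∈ orderedSpan := by
    intro a b
    have h₀ := traceFun_gpow_mem (a, 0, 0)
    have h₁ := traceFun_gpow_mem (a, 1, 0)
    simp only [gpow, Fin.val_zero, Fin.val_one, pow_zero, pow_one, mul_one] at h₀ h₁
    fin_cases b
    · simpa using h₁
    · simpa using traceFun_mul_mul_self_mem (k := g2) (cl_word_mem 1) h₀ h₁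
  rintro ⟨a, b, c⟩
  have h₀ := traceFun_gpow_mem (a, b, 0)
  simp only [gpow, Fin.val_zero, pow_zero, mul_one] at h₀
  fin_cases c
  · simpa [gpow] using base a b
  · simpa [gpow] using traceFun_swap_mem (a := g2) (b := g3) (cl_word_mem 1) (cl_word_mem 2) (cl_word_mem 5) h₀
      (base a b) (traceFun_mul_g3_mem h₀) (traceFun_mul_g3_mem (base a b))

theorem traceFun_mul_g1_mem {w : F3} (hw : traceFun w ∈ orderedSpan) :
    traceFun (w * g1) ∈ orderedSpan := by
  refine traceFun_mul_mem_of_gpow ?_ hw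
  have hpow : ∀ a : Fin 2, traceFun (g1 ^ (a : ℕ) * g1) ∈ orderedSpan := by
    intro a
    have h₀ := traceFun_gpow_mem (0, 0, 0)
    have h₁ := traceFun_gpow_mem (1, 0, 0)
    simp only [gpow, Fin.val_zero, Fin.val_one, pow_zero, pow_one, mul_one] at h₀ h₁
    fin_cases a
    · simpa using h₁
    · simpa using traceFun_mul_mul_self_mem (k := g1) (cl_word_mem 0) h₀ (by simpa using h₁)
  have base : ∀ a b : Fin 2, traceFun (g1 ^ (a : ℕ) * g2 ^ (b : ℕ) * g1) ∈ orderedSpan := by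
    intro a b
    have h₀ := traceFun_gpow_mem (a, 0, 0)
    simp only [gpow, Fin.val_zero, pow_zero, mul_one] at h₀
    fin_cases b
    · simpa using hpow a
    · simpa using traceFun_swap_mem (a := g1) (b := g2) (cl_word_mem 0) (cl_word_mem 1) (cl_word_mem 3) h₀
        (hpow a) (traceFun_mul_g2_mem h₀) (traceFun_mul_g2_mem (hpow a))
  rintro ⟨a, b, c⟩
  have h₀ := traceFun_gpow_mem (a, b, 0)
  simp only [gpow, Fin.val_zero, pow_zero, mul_one] at h₀
  fin_cases c
  · simpa [gpow] using base a b
  · simpa [gpow] using traceFun_swap_mem (a := g1) (b := g3) (cl_word_mem 0) (cl_word_mem 2) (cl_word_mem 4) h₀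
      (base a b) (traceFun_mul_g3_mem h₀) (traceFun_mul_g3_mem (base a b))

theorem traceFun_mem (w : F3) : traceFun w ∈ orderedSpan := by
  have hgen : ∀ (j : Fin 3) {v : F3}, traceFun v ∈ orderedSpan →
      traceFun (v * FreeGroup.of j) ∈ orderedSpan := by
    intro j v hv
    fin_cases j
    · exact traceFun_mul_g1_mem hv
    · exact traceFun_mul_g2_mem hv
    · exact traceFun_mul_g3_mem hv
  have hcl : ∀ j : Fin 3, cl ℂ (FreeGroup.of j) ∈ Phi.range := by
    intro j
    fin_cases j
    · exact cl_word_mem 0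
    · exact cl_word_mem 1
    · exact cl_word_mem 2
  suffices h : ∀ v : F3, traceFun v ∈ orderedSpan → traceFun (v * w) ∈ orderedSpan by
    simpa using h 1 (by simpa [gpow] using traceFun_gpow_mem (0, 0, 0))
  induction w using FreeGroup.induction_on with
  | C1 => simp
  | of j => exact fun v hv => hgen j hv
  | inv_of j _ => exact fun v hv => traceFun_mul_inv_mem (hcl j) hv (hgen j hv)
  | mul x y hx hy =>
    intro v hv
    rw [← mul_assoc]
    exact hy _ (hx _ hv)

theorem cl_gpow_mem (i : Fin 2 × Fin 2 × Fin 2) : cl ℂ (gpow i) ∈ Phi.range := by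
  obtain ⟨a, b, c⟩ := i
  fin_cases a <;> fin_cases b <;> fin_cases c <;> simp [gpow]
  · rw [cl_one]
    exact ⟨2, map_ofNat _ 2⟩
  exacts [cl_word_mem 2, cl_word_mem 1, cl_word_mem 5, cl_word_mem 0, cl_word_mem 4,
    cl_word_mem 3, cl_word_mem 6]

theorem cl_mem_range (w : F3) : cl ℂ w ∈ Phi.range := by
  have key : ∀ f ∈ orderedSpan, f 1 ∈ Phi.range := by
    intro f hf
    induction hf using Submodule.span_induction with
    | mem f hf =>
      obtain ⟨i, rfl⟩ := hf
      simpa [traceFun] using cl_gpow_mem i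
    | zero => exact Phi.range.zero_mem
    | add f g _ _ hf hg => exact Phi.range.add_mem hf hg
    | smul a f _ hf => exact Phi.range.mul_mem a.2 hf
  simpa [traceFun] using key _ (traceFun_mem w)

theorem Phi_surjective : Function.Surjective Phi := by
  intro s
  obtain ⟨p, rfl⟩ := Ideal.Quotient.mk_surjective s
  change _ ∈ Phi.range
  induction p using MvPolynomial.induction_on with
  | C a => exact Phi.range.algebraMap_mem a
  | add p q hp hq => rw [map_add]; exact Phi.range.add_mem hp hq
  | mul_X p w hp => rw [map_mul]; exact Phi.range.mul_mem hp (cl_mem_range w)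

theorem cl_mul_sub_cl_mul_mem {J : Ideal (SkeinAlgebra ℂ F3)} {α β : F3}
    (h : ∀ i, cl ℂ (α * gpow i) - cl ℂ (β * gpow i) ∈ J) (w : F3) :
    cl ℂ (α * w) - cl ℂ (β * w) ∈ J := by
  have key : ∀ f ∈ orderedSpan, f α - f β ∈ J := by
    intro f hf
    induction hf using Submodule.span_induction with
    | mem f hf =>
      obtain ⟨i, rfl⟩ := hf
      exact h i
    | zero => simp
    | add f g _ _ hf hg =>
      simp only [Pi.add_apply, add_sub_add_comm]
      exact J.add_mem hf hg
    | smul a f _ hf =>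
      simp only [Pi.smul_apply, Subalgebra.smul_def, smul_eq_mul, ← mul_sub]
      exact J.mul_mem_left _ hf
  exact key _ (traceFun_mem w)

end OrderedWords

section NormalSubgroup

variable {R G : Type*} [CommRing R] [Group G]

/-- The elements acting trivially on all classes modulo an ideal of the skein algebra. -/
def trivialModulo (J : Ideal (SkeinAlgebra R G)) : Subgroup G where
  carrier := {n | ∀ w, cl R (n * w) - cl R w ∈ J}
  one_mem' w := by simp
  mul_mem' {a b} ha hb w := by
    have := J.add_mem (ha (b * w)) (hb w)
    rwa [sub_add_sub_cancel, ← mul_assoc] at this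
  inv_mem' {a} ha w := by
    have := J.neg_mem (ha (a⁻¹ * w))
    rwa [neg_sub, mul_inv_cancel_left] at this

instance trivialModulo_normal (J : Ideal (SkeinAlgebra R G)) : (trivialModulo J).Normal where
  conj_mem n hn g w := by
    have := hn (g⁻¹ * w * g)
    rwa [← cl_mul_comm g (g⁻¹ * w), mul_inv_cancel_left, ← mul_assoc, ← cl_mul_comm g,
      ← mul_assoc, ← mul_assoc] at this

end NormalSubgroup

section Kernel

open Matrix

/-- The character of a representation into `SL₂(ℂ)`, as a character of the skein algebra. -/
def traceHom {G : Type*} [Group G] (ρ : G →* SpecialLinearGroup (Fin 2) ℂ) :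
    SkeinAlgebra ℂ G →ₐ[ℂ] ℂ :=
  Ideal.Quotient.liftₐ (skeinIdeal ℂ G) (aeval fun g => (ρ g : Matrix (Fin 2) (Fin 2) ℂ).trace) <| by
    intro p hp
    change p ∈ RingHom.ker (aeval fun g => (ρ g : Matrix (Fin 2) (Fin 2) ℂ).trace)
    revert p
    change skeinIdeal ℂ G ≤ _
    rw [skeinIdeal, Ideal.span_le]
    rintro p (rfl | ⟨g, h, rfl⟩)
    · simp [RingHom.mem_ker]
    · simp [RingHom.mem_ker, trace_fin_two, adjugate_fin_two,
        mul_apply, Fin.sum_univ_two]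
      ring

theorem traceHom_cl {G : Type*} [Group G] (ρ : G →* SpecialLinearGroup (Fin 2) ℂ) (g : G) :
    traceHom ρ (cl ℂ g) = (ρ g : Matrix (Fin 2) (Fin 2) ℂ).trace := by
  simp [traceHom, cl]

theorem aeval_trace_eq_zero (ρ : F3 →* SpecialLinearGroup (Fin 2) ℂ)
    {p : MvPolynomial (Fin 7) ℂ} (hp : Phi p = 0) :
    aeval (fun i => (ρ (word i) : Matrix (Fin 2) (Fin 2) ℂ).trace) p = 0 := by
  have h : (traceHom ρ).comp Phi =
      aeval (fun i => (ρ (word i) : Matrix (Fin 2) (Fin 2) ℂ).trace) := by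
    ext i
    simp [Phi, traceHom_cl]
  rw [← h, AlgHom.comp_apply, hp, map_zero]

theorem exists_add_inv_eq (t : ℂ) : ∃ c : ℂ, c ≠ 0 ∧ c + c⁻¹ = t := by
  obtain ⟨s, hs⟩ := IsAlgClosed.exists_pow_nat_eq (t ^ 2 - 4) (n := 2) (by norm_num)
  have h : (t + s) / 2 * ((t - s) / 2) = 1 := by linear_combination -hs / 4
  have hne : (t + s) / 2 ≠ 0 := left_ne_zero_of_mul_eq_one h
  refine ⟨(t + s) / 2, hne, ?_⟩
  rw [inv_eq_of_mul_eq_one_right h]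
  ring

/-- Points of the hypersurface `K = 0` off a discriminant are characters. -/
theorem exists_rep (v : Fin 7 → ℂ) (hK : aeval v K = 0)
    (hD : v 0 ^ 2 + v 1 ^ 2 + v 3 ^ 2 - v 0 * v 1 * v 3 - 4 ≠ 0) :
    ∃ ρ : F3 →* SpecialLinearGroup (Fin 2) ℂ,
      ∀ i, (ρ (word i) : Matrix (Fin 2) (Fin 2) ℂ).trace = v i := by
  obtain ⟨c, hc, hx12⟩ := exists_add_inv_eq (v 3)
  obtain ⟨p, q, r, s, hx3, hx13, hx23, hx123⟩ : ∃ p q r s : ℂ, p + s = v 2 ∧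
      v 0 * p - r + q = v 4 ∧ c * r - c⁻¹ * q + v 1 * s = v 5 ∧
      c⁻¹ * p + (v 0 * c - v 1) * r + c * s = v 6 := by
    obtain ⟨D, hDdef⟩ : ∃ D, D = v 0 ^ 2 + v 1 ^ 2 + v 3 ^ 2 - v 0 * v 1 * v 3 - 4 := ⟨_, rfl⟩
    rw [← hDdef] at hD
    have hcc : c * c⁻¹ = 1 := mul_inv_cancel₀ hc
    generalize c⁻¹ = d at *
    rw [← hx12] at hDdef
    obtain ⟨e, he⟩ : ∃ e, e = v 5 - v 1 * v 2 + d * v 4 := ⟨_, rfl⟩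
    obtain ⟨f, hf⟩ : ∃ f, f = v 6 - c * v 2 := ⟨_, rfl⟩
    obtain ⟨p, hp⟩ : ∃ p, p * D = e * (v 0 * c - v 1) - f * (c - d) :=
      ⟨_, div_mul_cancel₀ _ hD⟩
    obtain ⟨r, hr⟩ : ∃ r, r * D = (v 0 * d - v 1) * f - (d - c) * e :=
      ⟨_, div_mul_cancel₀ _ hD⟩
    have h₁ : p * (v 0 * d - v 1) + r * (c - d) = e := by
      apply mul_right_cancel₀ hD
      linear_combination (v 0 * d - v 1) * hp + (c - d) * hr - e * hDdef
        + e * (v 0 ^ 2 - 4) * hcc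
    have h₂ : p * (d - c) + r * (v 0 * c - v 1) = f := by
      apply mul_right_cancel₀ hD
      linear_combination (d - c) * hp + (v 0 * c - v 1) * hr - f * hDdef
        + f * (v 0 ^ 2 - 4) * hcc
    exact ⟨p, v 4 - v 0 * p + r, r, v 2 - p, by ring, by ring,
      by linear_combination h₁ + he, by linear_combination h₂ + hf⟩
  have hdet : p * s - q * r = 1 := by
    have hid : (v 0 ^ 2 + v 1 ^ 2 + v 3 ^ 2 - v 0 * v 1 * v 3 - 4) * (p * s - q * r - 1) = 0 := by
      simp only [K, x1, x2, x3, x12, x13, x23, x123, map_add, map_sub, map_mul, map_pow, aeval_X,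
        map_ofNat, ← hx3, ← hx13, ← hx23, ← hx123, ← hx12] at hK ⊢
      refine neg_eq_zero.1 (Eq.trans ?_ hK)
      field_simp
      ring
    exact sub_eq_zero.1 ((mul_eq_zero.1 hid).resolve_left hD)
  let A : SpecialLinearGroup (Fin 2) ℂ := ⟨!![v 0, -1; 1, 0], by simp [det_fin_two]⟩
  let B : SpecialLinearGroup (Fin 2) ℂ := ⟨!![0, c; -c⁻¹, v 1], by simp [det_fin_two, hc]⟩
  let C : SpecialLinearGroup (Fin 2) ℂ := ⟨!![p, q; r, s], by simp [det_fin_two, hdet]⟩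
  obtain ⟨ρ, hA, hB, hC⟩ : ∃ ρ : F3 →* SpecialLinearGroup (Fin 2) ℂ,
      ρ g1 = A ∧ ρ g2 = B ∧ ρ g3 = C :=
    ⟨FreeGroup.lift ![A, B, C], by simp [g1], by simp [g2], by simp [g3]⟩
  have hA' : (A : Matrix (Fin 2) (Fin 2) ℂ) = !![v 0, -1; 1, 0] := rfl
  have hB' : (B : Matrix (Fin 2) (Fin 2) ℂ) = !![0, c; -c⁻¹, v 1] := rfl
  have hC' : (C : Matrix (Fin 2) (Fin 2) ℂ) = !![p, q; r, s] := rfl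
  clear_value A B C
  refine ⟨ρ, fun i => ?_⟩
  fin_cases i <;>
    simp [word, hA, hB, hC, hA', hB', hC', trace_fin_two]
  · exact hx3
  · linear_combination hx12
  · linear_combination hx13
  · linear_combination hx23
  · linear_combination hx123

/-- The sum of the roots of `K` as a monic quadratic polynomial in `x₁₂₃`. -/
def rootSum : MvPolynomial (Fin 6) ℂ :=
  X 3 * X 2 + X 4 * X 1 + X 5 * X 0 - X 0 * X 1 * X 2

/-- The product of the roots of `K` as a monic quadratic polynomial in `x₁₂₃`. -/
def rootProd : MvPolynomial (Fin 6) ℂ :=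
  X 0 ^ 2 + X 1 ^ 2 + X 2 ^ 2 + X 3 ^ 2 + X 5 ^ 2 + X 4 ^ 2
    - X 0 * X 1 * X 3 - X 0 * X 2 * X 4 - X 1 * X 2 * X 5 + X 3 * X 4 * X 5 - 4

theorem K_eq : K = X (Fin.last 6) ^ 2 - rename Fin.castSucc rootSum * X (Fin.last 6)
    + rename Fin.castSucc rootProd := by
  simp only [K, rootSum, rootProd, x1, x2, x3, x12, x13, x23, x123, map_add, map_sub, map_mul,
    map_pow, map_ofNat, rename_X]
  change X 6 ^ 2 - (X 3 * X 2 + X 4 * X 1 + X 5 * X 0 - X 0 * X 1 * X 2) * X 6 + X 0 ^ 2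
      + X 1 ^ 2 + X 2 ^ 2 + X 3 ^ 2 + X 5 ^ 2 + X 4 ^ 2 - X 0 * X 1 * X 3 - X 0 * X 2 * X 4
      - X 1 * X 2 * X 5 + X 3 * X 4 * X 5 - 4
    = X 6 ^ 2 - (X 3 * X 2 + X 4 * X 1 + X 5 * X 0 - X 0 * X 1 * X 2) * X 6 + (X 0 ^ 2
      + X 1 ^ 2 + X 2 ^ 2 + X 3 ^ 2 + X 5 ^ 2 + X 4 ^ 2 - X 0 * X 1 * X 3 - X 0 * X 2 * X 4
      - X 1 * X 2 * X 5 + X 3 * X 4 * X 5 - 4)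
  ring

theorem exists_remainder (p : MvPolynomial (Fin 7) ℂ) : ∃ a b : MvPolynomial (Fin 6) ℂ,
    p - (rename Fin.castSucc a + rename Fin.castSucc b * X (Fin.last 6)) ∈ Ideal.span {K} := by
  simp only [Ideal.mem_span_singleton']
  induction p using MvPolynomial.induction_on with
  | C r => exact ⟨C r, 0, 0, by simp⟩
  | add p q hp hq =>
    obtain ⟨a, b, k, h⟩ := hp
    obtain ⟨a', b', k', h'⟩ := hq
    refine ⟨a + a', b + b', k + k', ?_⟩
    simp only [map_add]
    linear_combination h + h'
  | mul_X p i hp =>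
    obtain ⟨a, b, k, h⟩ := hp
    cases i using Fin.lastCases with
    | last =>
      refine ⟨-(b * rootProd), a + b * rootSum,
        k * X (Fin.last 6) + rename Fin.castSucc b, ?_⟩
      simp only [map_add, map_mul, map_neg]
      linear_combination X (Fin.last 6) * h + rename Fin.castSucc b * K_eq
    | cast j =>
      refine ⟨a * X j, b * X j, k * X j.castSucc, ?_⟩
      simp only [map_mul, rename_X]
      linear_combination X j.castSucc * h

theorem eval_snoc_rename (y : Fin 6 → ℂ) (z : ℂ) (a : MvPolynomial (Fin 6) ℂ) :
    eval (Fin.snoc y z : Fin 7 → ℂ) (rename Fin.castSucc a) = eval y a := by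
  rw [eval_rename]
  congr 2
  funext j
  exact Fin.snoc_castSucc (α := fun _ => ℂ) z y j

theorem aeval_eq_zero_of_Phi_eq_zero {p : MvPolynomial (Fin 7) ℂ} (hp : Phi p = 0)
    (v : Fin 7 → ℂ) (hK : aeval v K = 0)
    (hD : v 0 ^ 2 + v 1 ^ 2 + v 3 ^ 2 - v 0 * v 1 * v 3 - 4 ≠ 0) : aeval v p = 0 := by
  obtain ⟨ρ, hρ⟩ := exists_rep v hK hD
  rw [← funext hρ]
  exact aeval_trace_eq_zero ρ hp

theorem ker_Phi_le : RingHom.ker Phi ≤ Ideal.span {K} := by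
  intro p hp
  rw [RingHom.mem_ker] at hp
  obtain ⟨a, b, hab⟩ := exists_remainder p
  let D : MvPolynomial (Fin 6) ℂ := X 0 ^ 2 + X 1 ^ 2 + X 3 ^ 2 - X 0 * X 1 * X 3 - 4
  let E : MvPolynomial (Fin 6) ℂ := rootSum ^ 2 - 4 * rootProd
  have hDE : D * E ≠ 0 := by
    intro h
    have := congrArg (aeval (0 : Fin 6 → ℂ)) h
    simp only [D, E, rootSum, rootProd, map_add, map_sub, map_mul, map_pow, map_ofNat, map_zero,
      aeval_X, Pi.zero_apply] at this
    norm_num at this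
  have key : ∀ y : Fin 6 → ℂ, aeval y (D * E) ≠ 0 → aeval y a = 0 ∧ aeval y b = 0 := by
    intro y hy
    rw [map_mul] at hy
    have hD := left_ne_zero_of_mul hy
    have hE := right_ne_zero_of_mul hy
    have hroot : ∀ z : ℂ, z ^ 2 - aeval y rootSum * z + aeval y rootProd = 0 →
        aeval y a + aeval y b * z = 0 := by
      intro z hz
      have hK : aeval (Fin.snoc y z : Fin 7 → ℂ) K = 0 := by
        rw [K_eq]
        simpa [-Fin.reduceLast, eval_snoc_rename] using hz
      have hpv := aeval_eq_zero_of_Phi_eq_zero hp (Fin.snoc y z) hK (by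
        simp only [D, map_add, map_sub, map_mul, map_pow, map_ofNat, aeval_X] at hD
        exact hD)
      obtain ⟨k, hk⟩ := Ideal.mem_span_singleton'.1 hab
      have := congrArg (aeval (Fin.snoc y z : Fin 7 → ℂ)) hk
      rw [map_mul, map_sub, hK, hpv, mul_zero, zero_sub, eq_comm, neg_eq_zero] at this
      simpa [-Fin.reduceLast, eval_snoc_rename] using this
    obtain ⟨s, hs⟩ := IsAlgClosed.exists_pow_nat_eq (aeval y E) (n := 2) (by norm_num)
    have hs₀ : s ≠ 0 := by
      rintro rfl
      exact hE (by simpa using hs.symm)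
    simp only [E, map_sub, map_mul, map_pow, map_ofNat] at hs
    have h₁ := hroot ((aeval y rootSum + s) / 2) (by linear_combination hs / 4)
    have h₂ := hroot ((aeval y rootSum - s) / 2) (by linear_combination hs / 4)
    have hb : aeval y b = 0 := by
      apply mul_right_cancel₀ hs₀
      linear_combination h₁ - h₂
    exact ⟨by simpa [hb] using h₁, hb⟩
  have hzero : ∀ q : MvPolynomial (Fin 6) ℂ,
      (∀ y : Fin 6 → ℂ, aeval y (D * E) ≠ 0 → aeval y q = 0) → q = 0 := by
    intro q hq
    refine (mul_eq_zero.1 (?_ : D * E * q = 0)).resolve_left hDE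
    refine MvPolynomial.funext fun y => ?_
    rw [← coe_aeval_eq_eval]
    change aeval y _ = aeval y 0
    rw [map_mul, map_zero, mul_eq_zero]
    exact or_iff_not_imp_left.2 (hq y)
  have ha := hzero a fun y hy => (key y hy).1
  have hb := hzero b fun y hy => (key y hy).2
  simpa [ha, hb] using hab

end Kernel

/-- Lemma 2.3: with `G = F₃/N` the group presented by the relations `α = β`, `γ = δ`,
`ι : F₃ → G` the quotient map, and `Ī` the ideal generated by `K` and the fixed
difference polynomials, for all `u, v ∈ F₃` with `ι u = ι v` and all polynomials
`P_u, P_v` with `Φ(P_u) = [u]`, `Φ(P_v) = [v]`, one has `P_u - P_v ∈ Ī`. -/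
theorem skein_differences_mem_of_eq (α β γ δ : F3)
    (Pa Pb Pc Pd : Fin 2 × Fin 2 × Fin 2 → MvPolynomial (Fin 7) ℂ)
    (hPa : ∀ i, Phi (Pa i) = cl ℂ (α * gpow i))
    (hPb : ∀ i, Phi (Pb i) = cl ℂ (β * gpow i))
    (hPc : ∀ i, Phi (Pc i) = cl ℂ (γ * gpow i))
    (hPd : ∀ i, Phi (Pd i) = cl ℂ (δ * gpow i)) :
    letI N : Subgroup F3 := Subgroup.normalClosure {α * β⁻¹, γ * δ⁻¹}
    letI ι : F3 →* F3 ⧸ N := QuotientGroup.mk' N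
    letI Ibar : Ideal (MvPolynomial (Fin 7) ℂ) :=
      Ideal.span ({K} ∪ Set.range (fun i => Pa i - Pb i) ∪
        Set.range (fun i => Pc i - Pd i))
    ∀ u v : F3, ι u = ι v → ∀ Pu Pv : MvPolynomial (Fin 7) ℂ,
      Phi Pu = cl ℂ u → Phi Pv = cl ℂ v → Pu - Pv ∈ Ibar := by
  intro u v huv Pu Pv hPu hPv
  set I : Ideal (MvPolynomial (Fin 7) ℂ) :=
    Ideal.span ({K} ∪ Set.range (fun i => Pa i - Pb i) ∪ Set.range (fun i => Pc i - Pd i))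
  have hKI : RingHom.ker Phi ≤ I :=
    ker_Phi_le.trans (Ideal.span_mono fun _ h => Or.inl (Or.inl h))
  have hab : ∀ w, cl ℂ (α * w) - cl ℂ (β * w) ∈ I.map Phi := by
    refine cl_mul_sub_cl_mul_mem fun i => ?_
    rw [← hPa, ← hPb, ← map_sub]
    exact Ideal.mem_map_of_mem Phi (Ideal.subset_span (Or.inl (Or.inr ⟨i, rfl⟩)))
  have hcd : ∀ w, cl ℂ (γ * w) - cl ℂ (δ * w) ∈ I.map Phi := by
    refine cl_mul_sub_cl_mul_mem fun i => ?_
    rw [← hPc, ← hPd, ← map_sub]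
    exact Ideal.mem_map_of_mem Phi (Ideal.subset_span (Or.inr ⟨i, rfl⟩))
  have hN : Subgroup.normalClosure {α * β⁻¹, γ * δ⁻¹} ≤ trivialModulo (I.map Phi) := by
    refine Subgroup.normalClosure_le_normal ?_
    rintro n (rfl | rfl) w
    · simpa [mul_assoc] using hab (β⁻¹ * w)
    · simpa [mul_assoc] using hcd (δ⁻¹ * w)
  have hmem : u * v⁻¹ ∈ Subgroup.normalClosure {α * β⁻¹, γ * δ⁻¹} := by
    rw [← QuotientGroup.eq_one_iff, QuotientGroup.mk_mul, QuotientGroup.mk_inv]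
    exact mul_inv_eq_one.2 huv
  have h := hN hmem v
  rw [inv_mul_cancel_right, ← hPu, ← hPv, ← map_sub,
    Ideal.mem_map_iff_of_surjective Phi Phi_surjective] at h
  obtain ⟨q, hq, hq'⟩ := h
  have hker : Pu - Pv - q ∈ I := hKI (by rw [RingHom.mem_ker, map_sub, hq', sub_self])
  simpa using I.add_mem hker hq
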